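/- Embed U_{n−1} in U_n as {u ∈ U_n : u_{ij} ≠ 0 for i ≠ j implies i < j < n}. Then for every F_q-labeled set partition μ of {1,2,…,n−1}, Ind_{U_{n−1}}^{U_n}(χ^μ) = χ^μ *_1 χ^{{n}}, where *_1 is the combinatorial product defined in the context. -/

import Mathlib

/-!
STATEMENT 16: Embed U_{n−1} in U_n as {u ∈ U_n : u_{ij} ≠ 0, i ≠ j ⟹ i < j < n}.
Then for every F_q-labeled set partition μ of {1,…,n−1},
Ind_{U_{n−1}}^{U_n}(χ^μ) = χ^μ *_1 χ^{{n}}, where *_1 is the combinatorial product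
defined recursively below (cases read in order).
-/
open scoped Classical

noncomputable section

def setFinset {α : Type*} [Fintype α] (S : Set α) : Finset α :=
  Finset.univ.filter (· ∈ S)

/-- A strict partial order on `{1,…,n}` that is a subrelation of the usual order. -/
def IsPatternOrder {n : ℕ} (P : Fin n → Fin n → Prop) : Prop :=
  (∀ i j, P i j → i < j) ∧ ∀ i j k, P i j → P j k → P i k

/-- The pattern group `U_P` of unipotent upper-triangular matrices supported on `P`. -/
def patternGroup (F : Type*) [Field F] {n : ℕ} (P : Fin n → Fin n → Prop) :
    Set (Matrix (Fin n) (Fin n) F) :=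
  {u | (∀ i, u i i = 1) ∧ ∀ i j, i ≠ j → u i j ≠ 0 → P i j}

/-- `χ` is constant on the superclasses of `G`: `u ~ v` iff `v − 1 ∈ G(u−1)G`. -/
def IsSuperclassFn {A : Type*} [Ring A] (G : Set A) (χ : A → ℂ) : Prop :=
  ∀ u ∈ G, ∀ v ∈ G, (∃ x ∈ G, ∃ y ∈ G, v - 1 = x * (u - 1) * y) → χ u = χ v

/-- Superinduction `SInd_H^G(χ)(g) = (1/(|G||H|)) Σ_{x,y∈G} χ̇(x(g−1)y + 1)`. -/
def SInd {A : Type*} [Ring A] [Fintype A] (G H : Set A) (χ : A → ℂ) (g : A) : ℂ :=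
  (((setFinset G).card : ℂ) * ((setFinset H).card : ℂ))⁻¹ *
    ∑ x ∈ setFinset G, ∑ y ∈ setFinset G,
      if x * (g - 1) * y + 1 ∈ H then χ (x * (g - 1) * y + 1) else 0

/-- Induction `Ind_H^G(χ)(g) = (1/|H|) Σ_{y∈G} χ̇(y⁻¹ g y)`. -/
def Ind {A : Type*} [Ring A] [Fintype A] (G H : Set A) (χ : A → ℂ) (g : A) : ℂ :=
  ((setFinset H).card : ℂ)⁻¹ *
    ∑ y ∈ setFinset G,
      if Ring.inverse y * g * y ∈ H then χ (Ring.inverse y * g * y) else 0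

open Matrix

/-- The pairing `⟪a,b⟫ = Σ_{ij} a_{ij} b_{ij}`, identifying a matrix `a` with the
linear functional `b ↦ ⟪a,b⟫`. -/
def pairF {F : Type*} [Field F] {n : ℕ} (a b : Matrix (Fin n) (Fin n) F) : F :=
  ∑ i, ∑ j, a i j * b i j

/-- Projection of a matrix onto the entries supported on `P` (the matrix model of
restricting a functional to `n_P`). -/
def dproj {F : Type*} [Field F] {n : ℕ} (P : Fin n → Fin n → Prop)
    (m : Matrix (Fin n) (Fin n) F) : Matrix (Fin n) (Fin n) F :=
  Matrix.of fun i j => if P i j then m i j else 0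

/-- The left action `u·λ`, via `(uλ)(x−1) = λ(u⁻¹(x−1))`, in the matrix model:
`uλ = proj_P((u⁻¹)ᵀ λ)`. -/
def lact {F : Type*} [Field F] {n : ℕ} (P : Fin n → Fin n → Prop)
    (u lam : Matrix (Fin n) (Fin n) F) : Matrix (Fin n) (Fin n) F :=
  dproj P ((Ring.inverse u)ᵀ * lam)

/-- The right action `λ·v`, via `(λv)(x−1) = λ((x−1)v⁻¹)`:  `λv = proj_P(λ (v⁻¹)ᵀ)`. -/
def ract {F : Type*} [Field F] {n : ℕ} (P : Fin n → Fin n → Prop)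
    (lam v : Matrix (Fin n) (Fin n) F) : Matrix (Fin n) (Fin n) F :=
  dproj P (lam * (Ring.inverse v)ᵀ)

/-- The two-sided action `u·λ·v = proj_P((u⁻¹)ᵀ λ (v⁻¹)ᵀ)`. -/
def biact {F : Type*} [Field F] {n : ℕ} (P : Fin n → Fin n → Prop)
    (u lam v : Matrix (Fin n) (Fin n) F) : Matrix (Fin n) (Fin n) F :=
  dproj P ((Ring.inverse u)ᵀ * lam * (Ring.inverse v)ᵀ)

/-- The left orbit `U_P·λ`. -/
def leftOrbit (F : Type*) [Field F] {n : ℕ} (P : Fin n → Fin n → Prop)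
    (lam : Matrix (Fin n) (Fin n) F) : Set (Matrix (Fin n) (Fin n) F) :=
  {m | ∃ u ∈ patternGroup F P, m = lact P u lam}

/-- The right orbit `λ·U_P`. -/
def rightOrbit (F : Type*) [Field F] {n : ℕ} (P : Fin n → Fin n → Prop)
    (lam : Matrix (Fin n) (Fin n) F) : Set (Matrix (Fin n) (Fin n) F) :=
  {m | ∃ v ∈ patternGroup F P, m = ract P lam v}

/-- The two-sided orbit `U_P·λ·U_P`. -/
def biOrbit (F : Type*) [Field F] {n : ℕ} (P : Fin n → Fin n → Prop)
    (lam : Matrix (Fin n) (Fin n) F) : Set (Matrix (Fin n) (Fin n) F) :=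
  {m | ∃ u ∈ patternGroup F P, ∃ v ∈ patternGroup F P, m = biact P u lam v}

/-- The supercharacter
`χ^λ(u) = (|U_P λ|/|U_P λ U_P|) Σ_{μ ∈ U_P(−λ)U_P} θ(μ(u−1))`. -/
def superchar {F : Type*} [Field F] [Fintype F] {n : ℕ} (P : Fin n → Fin n → Prop)
    (θ : F → ℂ) (lam : Matrix (Fin n) (Fin n) F) (u : Matrix (Fin n) (Fin n) F) : ℂ :=
  (((setFinset (leftOrbit F P lam)).card : ℂ) / ((setFinset (biOrbit F P lam)).card : ℂ)) *
    ∑ ν ∈ setFinset (biOrbit F P (-lam)), θ (pairF ν (u - 1))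

/-- ℕ-indexed (1-based) matrix model of an F_q-labeled set partition:
`mu i j = t ≠ 0` encodes an arc `i ⌢_t j`. -/
abbrev SPF (F : Type*) := ℕ → ℕ → F

/-- Replace the `(i,k)` entry of `mu` by `t` (adjoin/delete/relabel an arc). -/
def updArc {F : Type*} (mu : SPF F) (i k : ℕ) (t : F) : SPF F :=
  fun a b => if a = i ∧ b = k then t else mu a b

/-- The combinatorial product `μ *_i {k}`, a formal ℕ-linear (here ℂ-linear)
combination of labeled set partitions, defined by the recursion of the paper
(cases read in order). -/
noncomputable def lstar {F : Type*} [Field F] [Fintype F] (i k : ℕ) (mu : SPF F) :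
    SPF F →₀ ℂ :=
  if h0 : k ≤ i then (if i = k then Finsupp.single mu 1 else 0)
  else if h2 : ∃ l, k < l ∧ mu i l ≠ 0 then (Fintype.card F) • lstar (i + 1) k mu
  else if h3 : mu i k ≠ 0 then lstar (i + 1) k (updArc mu i k 0)
  else if h4 : ∃ j, j < k ∧ mu i j ≠ 0 then
    lstar (i + 1) k mu +
      ∑ t ∈ Finset.univ.filter (fun t : F => t ≠ 0),
        lstar (i + 1) (Classical.choose h4)
          (updArc (updArc mu i (Classical.choose h4) 0) i k t)
  else
    lstar (i + 1) k mu +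
      ∑ t ∈ Finset.univ.filter (fun t : F => t ≠ 0), Finsupp.single (updArc mu i k t) 1
termination_by k - i
decreasing_by
  · omega
  · omega
  · omega
  · have := (Classical.choose_spec h4).1; omega
  · omega

/-- Convert the 1-based ℕ-indexed model to an `n × n` matrix (entry `(i,j)`, 0-based,
is `mu (i+1) (j+1)`). -/
def toMat (F : Type*) [Field F] (n : ℕ) (mu : SPF F) : Matrix (Fin n) (Fin n) F :=
  Matrix.of fun i j => mu ((i : ℕ) + 1) ((j : ℕ) + 1)

/-- Extend `λ ↦ χ^λ` linearly: the class function `Σ_λ c_λ χ^λ` attached to a formal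
combination `c` of labeled set partitions, the supercharacters taken for pattern `P`. -/
noncomputable def charOfComb {F : Type*} [Field F] [Fintype F] {n : ℕ}
    (P : Fin n → Fin n → Prop) (θ : F → ℂ) (c : SPF F →₀ ℂ)
    (g : Matrix (Fin n) (Fin n) F) : ℂ :=
  c.sum fun lam coeff => coeff * superchar P θ (toMat F n lam) g

/-- The functions that agree with `c₀` outside `K`. -/
def agreeOff {F : Type*} [Fintype F] {n : ℕ} (K : Fin n → Prop) (c₀ : Fin n → F) :
    Finset (Fin n → F) :=
  Finset.univ.filter fun c => ∀ k, ¬ K k → c k = c₀ k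

section AgreeOff

lemma mem_agreeOff {F : Type*} [Fintype F] {n : ℕ} {K : Fin n → Prop} {c₀ c : Fin n → F} :
    c ∈ agreeOff K c₀ ↔ ∀ k, ¬ K k → c k = c₀ k := by
  simp [agreeOff]

lemma self_mem_agreeOff {F : Type*} [Fintype F] {n : ℕ} (K : Fin n → Prop) (c₀ : Fin n → F) :
    c₀ ∈ agreeOff K c₀ :=
  mem_agreeOff.2 fun _ _ => rfl

lemma card_agreeOff_ne_zero {F : Type*} [Fintype F] {n : ℕ} (K : Fin n → Prop)
    (c₀ : Fin n → F) :
    ((agreeOff K c₀).card : ℂ) ≠ 0 := by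
  have : (agreeOff K c₀).card ≠ 0 := Finset.card_ne_zero_of_mem (self_mem_agreeOff K c₀)
  exact_mod_cast this

variable {F : Type*} [Field F] [Fintype F] {n : ℕ}

lemma sum_agreeOff_translate {K : Fin n → Prop} {b c₀ : Fin n → F} (hb : b ∈ agreeOff K c₀)
    (f : (Fin n → F) → ℂ) :
    ∑ c ∈ agreeOff K c₀, f c = ∑ d ∈ agreeOff K 0, f (b + d) := by
  rw [mem_agreeOff] at hb
  refine Finset.sum_nbij' (fun c => c - b) (fun d => b + d) ?_ ?_ ?_ ?_ ?_
  · intro c hc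
    rw [mem_agreeOff] at hc ⊢
    intro k hk
    simp [hc k hk, hb k hk]
  · intro d hd
    rw [mem_agreeOff] at hd ⊢
    intro k hk
    simp [hd k hk, hb k hk]
  · intro c _; simp
  · intro c _; simp
  · intro c _; simp

lemma card_agreeOff (K : Fin n → Prop) (c₀ : Fin n → F) :
    ((agreeOff K c₀).card : ℂ) = (agreeOff K (0 : Fin n → F)).card := by
  have := sum_agreeOff_translate (self_mem_agreeOff K c₀) (fun _ => 1)
  simpa using this

/-- Orthogonality relations for the additive character `θ` on a coordinate subspace. -/
lemma sum_agreeOff_addChar {θ : AddChar F ℂ} (hθ : ∃ a, θ a ≠ 1) (K : Fin n → Prop)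
    (c₀ w : Fin n → F) :
    ∑ c ∈ agreeOff K c₀, θ (w ⬝ᵥ c) =
      if ∀ k, K k → w k = 0 then ((agreeOff K c₀).card : ℂ) * θ (w ⬝ᵥ c₀) else 0 := by
  split_ifs with h
  · rw [← nsmul_eq_mul, ← Finset.sum_const]
    refine Finset.sum_congr rfl fun c hc => ?_
    rw [mem_agreeOff] at hc
    congr 1
    refine Finset.sum_congr rfl fun k _ => ?_
    by_cases hk : K k
    · simp [h k hk]
    · rw [hc k hk]
  · push Not at h
    obtain ⟨k, hk, hwk⟩ := h
    obtain ⟨a, ha⟩ := hθ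
    have hb : c₀ + Pi.single k (a / w k) ∈ agreeOff K c₀ := by
      rw [mem_agreeOff]
      intro l hl
      have : l ≠ k := by rintro rfl; exact hl hk
      simp [this]
    have h1 := sum_agreeOff_translate hb (fun c => θ (w ⬝ᵥ c))
    have h2 := sum_agreeOff_translate (self_mem_agreeOff K c₀) (fun c => θ (w ⬝ᵥ c))
    have h3 : ∑ d ∈ agreeOff K (0 : Fin n → F), θ (w ⬝ᵥ (c₀ + Pi.single k (a / w k) + d)) =
        θ a * ∑ d ∈ agreeOff K (0 : Fin n → F), θ (w ⬝ᵥ (c₀ + d)) := by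
      rw [Finset.mul_sum]
      refine Finset.sum_congr rfl fun d _ => ?_
      rw [← AddChar.map_add_eq_mul]
      congr 1
      rw [dotProduct_add, dotProduct_add, dotProduct_add, dotProduct_single,
        mul_div_cancel₀ _ hwk]
      ring
    rw [h3, ← h2] at h1
    have h4 : (1 - θ a) * ∑ c ∈ agreeOff K c₀, θ (w ⬝ᵥ c) = 0 := by
      rw [sub_mul, ← h1]; ring
    rcases mul_eq_zero.1 h4 with h5 | h5
    · exact absurd (sub_eq_zero.1 h5).symm ha
    · exact h5

end AgreeOff

section PatternGroup

variable {F : Type*} [Field F] {n : ℕ} {P : Fin n → Fin n → Prop}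

lemma apply_eq_of_mem_patternGroup {u : Matrix (Fin n) (Fin n) F} (hu : u ∈ patternGroup F P)
    {i j : Fin n} (h : ¬ P i j) : u i j = (1 : Matrix (Fin n) (Fin n) F) i j := by
  rcases eq_or_ne i j with rfl | hij
  · rw [hu.1, Matrix.one_apply_eq]
  · rw [Matrix.one_apply_ne hij]
    by_contra h0
    exact h (hu.2 i j hij h0)

lemma mem_patternGroup_iff (hP : IsPatternOrder P) {u : Matrix (Fin n) (Fin n) F} :
    u ∈ patternGroup F P ↔ ∀ i j, ¬ P i j → u i j = (1 : Matrix (Fin n) (Fin n) F) i j := by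
  refine ⟨fun hu i j h => apply_eq_of_mem_patternGroup hu h, fun h => ⟨fun i => ?_, ?_⟩⟩
  · rw [h i i fun hi => lt_irrefl _ (hP.1 _ _ hi), Matrix.one_apply_eq]
  · intro i j hij h0
    by_contra hp
    exact h0 (by rw [h i j hp, Matrix.one_apply_ne hij])

lemma one_mem_patternGroup : (1 : Matrix (Fin n) (Fin n) F) ∈ patternGroup F P :=
  ⟨fun i => Matrix.one_apply_eq i, fun _ _ hij h => absurd (Matrix.one_apply_ne hij) h⟩

lemma mul_mem_patternGroup (hP : IsPatternOrder P) {u v : Matrix (Fin n) (Fin n) F}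
    (hu : u ∈ patternGroup F P) (hv : v ∈ patternGroup F P) : u * v ∈ patternGroup F P := by
  have key : ∀ i j k, ¬ P i j → i ≠ k ∨ j ≠ k → u i k * v k j = 0 := by
    intro i j k hij hk
    by_contra h0
    have h1 : u i k ≠ 0 := left_ne_zero_of_mul h0
    have h2 : v k j ≠ 0 := right_ne_zero_of_mul h0
    rcases eq_or_ne i k with rfl | hik
    · rcases eq_or_ne j i with rfl | hji
      · simp at hk
      · exact hij (hv.2 _ _ hji.symm h2)
    · rcases eq_or_ne j k with rfl | hjk
      · exact hij (hu.2 _ _ hik h1)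
      · exact hij (hP.2 _ _ _ (hu.2 _ _ hik h1) (hv.2 _ _ hjk.symm h2))
  rw [mem_patternGroup_iff hP]
  intro i j hij
  rcases eq_or_ne i j with rfl | hne
  · rw [Matrix.mul_apply, Finset.sum_eq_single i, hu.1, hv.1]
    · simp
    · intro k _ hk
      exact key i i k hij (Or.inl hk.symm)
    · simp
  · rw [Matrix.mul_apply, Matrix.one_apply_ne hne]
    refine Finset.sum_eq_zero fun k _ => key i j k hij ?_
    by_contra! h
    exact hne (h.1.trans h.2.symm)

lemma isUnit_of_mem_patternGroup (hP : IsPatternOrder P) {u : Matrix (Fin n) (Fin n) F}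
    (hu : u ∈ patternGroup F P) : IsUnit u := by
  rw [Matrix.isUnit_iff_isUnit_det, Matrix.det_of_isUpperTriangular]
  · simp [hu.1]
  · intro i j hij
    by_contra h
    exact lt_asymm hij (hP.1 _ _ (hu.2 i j (ne_of_gt hij) h))

variable [Fintype F]

lemma mem_setFinset {α : Type*} [Fintype α] {S : Set α} {x : α} : x ∈ setFinset S ↔ x ∈ S := by
  simp [setFinset]

lemma inverse_mem_patternGroup (hP : IsPatternOrder P) {u : Matrix (Fin n) (Fin n) F}
    (hu : u ∈ patternGroup F P) : Ring.inverse u ∈ patternGroup F P := by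
  have hU := isUnit_of_mem_patternGroup hP hu
  have hs : Set.SurjOn (u * ·) (setFinset (patternGroup F P) : Set _)
      (setFinset (patternGroup F P) : Set (Matrix (Fin n) (Fin n) F)) := by
    apply Finset.surjOn_of_injOn_of_card_le
    · intro v hv
      simp only [Finset.mem_coe, mem_setFinset] at hv ⊢
      exact mul_mem_patternGroup hP hu hv
    · intro v _ w _ h
      exact hU.mul_left_cancel h
    · exact le_rfl
  obtain ⟨v, hv, h⟩ := hs (mem_setFinset.2 one_mem_patternGroup)
  have : Ring.inverse u = v := by
    apply hU.mul_left_cancel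
    rw [Ring.mul_inverse_cancel u hU]
    exact h.symm
  rw [this]
  exact mem_setFinset.1 hv

variable {M : Type*} [AddCommMonoid M]

lemma sum_patternGroup_mul_left (hP : IsPatternOrder P) {u : Matrix (Fin n) (Fin n) F}
    (hu : u ∈ patternGroup F P) (f : Matrix (Fin n) (Fin n) F → M) :
    ∑ x ∈ setFinset (patternGroup F P), f (u * x) = ∑ x ∈ setFinset (patternGroup F P), f x := by
  have hU := isUnit_of_mem_patternGroup hP hu
  refine Finset.sum_nbij' (u * ·) (Ring.inverse u * ·) ?_ ?_ ?_ ?_ ?_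
  · intro x hx
    rw [mem_setFinset] at hx ⊢
    exact mul_mem_patternGroup hP hu hx
  · intro x hx
    rw [mem_setFinset] at hx ⊢
    exact mul_mem_patternGroup hP (inverse_mem_patternGroup hP hu) hx
  · intro x _
    exact Ring.inverse_mul_cancel_left u x hU
  · intro x _
    exact Ring.mul_inverse_cancel_left u x hU
  · intro x _; rfl

lemma sum_patternGroup_mul_right (hP : IsPatternOrder P) {u : Matrix (Fin n) (Fin n) F}
    (hu : u ∈ patternGroup F P) (f : Matrix (Fin n) (Fin n) F → M) :
    ∑ x ∈ setFinset (patternGroup F P), f (x * u) = ∑ x ∈ setFinset (patternGroup F P), f x := by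
  have hU := isUnit_of_mem_patternGroup hP hu
  refine Finset.sum_nbij' (· * u) (· * Ring.inverse u) ?_ ?_ ?_ ?_ ?_
  · intro x hx
    rw [mem_setFinset] at hx ⊢
    exact mul_mem_patternGroup hP hx hu
  · intro x hx
    rw [mem_setFinset] at hx ⊢
    exact mul_mem_patternGroup hP hx (inverse_mem_patternGroup hP hu)
  · intro x _
    exact Ring.mul_inverse_cancel_right _ _ hU
  · intro x _
    exact Ring.inverse_mul_cancel_right _ _ hU
  · intro x _; rfl

lemma inverse_inverse_of_mem_patternGroup (hP : IsPatternOrder P)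
    {u : Matrix (Fin n) (Fin n) F} (hu : u ∈ patternGroup F P) :
    Ring.inverse (Ring.inverse u) = u := by
  have hU := isUnit_of_mem_patternGroup hP hu
  have hV := isUnit_of_mem_patternGroup hP (inverse_mem_patternGroup hP hu)
  apply hV.mul_left_cancel
  rw [Ring.mul_inverse_cancel _ hV, Ring.inverse_mul_cancel _ hU]

lemma sum_patternGroup_prod_rows (hP : IsPatternOrder P) (f : Fin n → (Fin n → F) → ℂ) :
    ∑ x ∈ setFinset (patternGroup F P), ∏ i, f i (fun j => x i j) =
      ∏ i, ∑ r ∈ agreeOff (P i) (Pi.single i (1 : F)), f i r := by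
  rw [Finset.prod_univ_sum]
  refine Finset.sum_nbij' (fun x i j => x i j) (fun x => Matrix.of fun i j => x i j) ?_ ?_ ?_ ?_ ?_
  · intro x hx
    rw [mem_setFinset, mem_patternGroup_iff hP] at hx
    rw [Fintype.mem_piFinset]
    intro i
    rw [mem_agreeOff]
    intro j hi
    rw [hx i j hi, Matrix.one_eq_pi_single]
  · intro x hx
    rw [Fintype.mem_piFinset] at hx
    rw [mem_setFinset, mem_patternGroup_iff hP]
    intro i j hi
    rw [Matrix.of_apply, mem_agreeOff.1 (hx i) j hi, Matrix.one_eq_pi_single]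
  · intro x _; rfl
  · intro x _; rfl
  · intro x _; rfl

lemma sum_patternGroup_prod_cols (hP : IsPatternOrder P) (f : Fin n → (Fin n → F) → ℂ) :
    ∑ x ∈ setFinset (patternGroup F P), ∏ j, f j (fun i => x i j) =
      ∏ j, ∑ c ∈ agreeOff (P · j) (Pi.single j (1 : F)), f j c := by
  rw [Finset.prod_univ_sum]
  refine Finset.sum_nbij' (fun x j i => x i j)
    (fun x => Matrix.of fun i j => x j i) ?_ ?_ ?_ ?_ ?_
  · intro x hx
    rw [mem_setFinset, mem_patternGroup_iff hP] at hx
    rw [Fintype.mem_piFinset]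
    intro j
    rw [mem_agreeOff]
    intro i hi
    rw [hx i j hi, Matrix.one_apply, Pi.single_apply]
  · intro x hx
    rw [Fintype.mem_piFinset] at hx
    rw [mem_setFinset, mem_patternGroup_iff hP]
    intro i j hi
    rw [Matrix.of_apply, mem_agreeOff.1 (hx j) i hi, Matrix.one_apply, Pi.single_apply]
  · intro x _; rfl
  · intro x _; rfl
  · intro x _; rfl

end PatternGroup

section Orbits

lemma sum_comp_eq_mul_sum_image {ι X : Type*} [DecidableEq X] (T : Finset ι) (Φ : ι → X) (c : ℂ)
    (hc : ∀ g ∈ T, (∑ h ∈ T, if Φ h = Φ g then (1 : ℂ) else 0) = c) (f : X → ℂ) :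
    ∑ g ∈ T, f (Φ g) = c * ∑ m ∈ T.image Φ, f m := by
  rw [Finset.sum_comp, Finset.mul_sum]
  refine Finset.sum_congr rfl fun m hm => ?_
  obtain ⟨g, hg, rfl⟩ := Finset.mem_image.1 hm
  rw [nsmul_eq_mul, ← hc g hg, Finset.sum_boole]

variable {F : Type*} [Field F] {n : ℕ} {P : Fin n → Fin n → Prop}

lemma dproj_transpose_mul_dproj (hP : IsPatternOrder P) {x y : Matrix (Fin n) (Fin n) F}
    (hx : x ∈ patternGroup F P) (hy : y ∈ patternGroup F P) (m : Matrix (Fin n) (Fin n) F) :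
    dproj P (xᵀ * dproj P m * yᵀ) = dproj P (xᵀ * m * yᵀ) := by
  ext i j
  simp only [dproj, Matrix.of_apply]
  split_ifs with hij
  · simp only [Matrix.mul_apply, Matrix.of_apply, Matrix.transpose_apply]
    refine Finset.sum_congr rfl fun l _ => ?_
    by_cases hl : y j l = 0
    · simp [hl]
    congr 1
    refine Finset.sum_congr rfl fun k _ => ?_
    by_cases hk : x k i = 0
    · simp [hk]
    have hkj : P k j := by
      rcases eq_or_ne k i with rfl | hki
      · exact hij
      · exact hP.2 _ _ _ (hx.2 _ _ hki hk) hij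
    have hkl : P k l := by
      rcases eq_or_ne j l with rfl | hjl
      · exact hkj
      · exact hP.2 _ _ _ hkj (hy.2 _ _ hjl hl)
    rw [if_pos hkl]
  · rfl

lemma dproj_neg (m : Matrix (Fin n) (Fin n) F) : dproj P (-m) = -dproj P m := by
  ext i j
  simp only [dproj, Matrix.of_apply, Matrix.neg_apply]
  split_ifs <;> simp

lemma pairF_eq_trace (a b : Matrix (Fin n) (Fin n) F) : pairF a b = (aᵀ * b).trace := by
  simp only [pairF, Matrix.trace, Matrix.diag_apply, Matrix.mul_apply, Matrix.transpose_apply]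
  exact Finset.sum_comm

lemma pairF_dproj (hP : IsPatternOrder P) {u : Matrix (Fin n) (Fin n) F}
    (hu : u ∈ patternGroup F P) (m : Matrix (Fin n) (Fin n) F) :
    pairF (dproj P m) (u - 1) = pairF m (u - 1) := by
  refine Finset.sum_congr rfl fun i _ => Finset.sum_congr rfl fun j _ => ?_
  simp only [dproj, Matrix.of_apply]
  split_ifs with hij
  · rfl
  · rw [Matrix.sub_apply, (mem_patternGroup_iff hP).1 hu i j hij, sub_self, mul_zero, mul_zero]

lemma pairF_transpose_mul (x y m b : Matrix (Fin n) (Fin n) F) :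
    pairF (xᵀ * m * yᵀ) b = pairF m (x * b * y) := by
  rw [pairF_eq_trace, pairF_eq_trace, Matrix.transpose_mul, Matrix.transpose_mul,
    Matrix.transpose_transpose, Matrix.transpose_transpose, Matrix.mul_assoc, Matrix.trace_mul_comm]
  simp only [Matrix.mul_assoc]

variable [Fintype F]

lemma dproj_eq_of_biact_eq (hP : IsPatternOrder P) {x y : Matrix (Fin n) (Fin n) F}
    (hx : x ∈ patternGroup F P) (hy : y ∈ patternGroup F P) {a b : Matrix (Fin n) (Fin n) F}
    (h : dproj P (xᵀ * a * yᵀ) = dproj P (xᵀ * b * yᵀ)) : dproj P a = dproj P b := by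
  have key : ∀ m : Matrix (Fin n) (Fin n) F,
      dproj P ((Ring.inverse x)ᵀ * dproj P (xᵀ * m * yᵀ) * (Ring.inverse y)ᵀ) = dproj P m := by
    intro m
    rw [dproj_transpose_mul_dproj hP (inverse_mem_patternGroup hP hx)
      (inverse_mem_patternGroup hP hy)]
    have hx1 : (Ring.inverse x)ᵀ * xᵀ = 1 := by
      rw [← Matrix.transpose_mul, Ring.mul_inverse_cancel _ (isUnit_of_mem_patternGroup hP hx),
        Matrix.transpose_one]
    have hy1 : yᵀ * (Ring.inverse y)ᵀ = 1 := by
      rw [← Matrix.transpose_mul, Ring.inverse_mul_cancel _ (isUnit_of_mem_patternGroup hP hy),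
        Matrix.transpose_one]
    congr 1
    calc (Ring.inverse x)ᵀ * (xᵀ * m * yᵀ) * (Ring.inverse y)ᵀ
        = ((Ring.inverse x)ᵀ * xᵀ) * m * (yᵀ * (Ring.inverse y)ᵀ) := by
          simp only [Matrix.mul_assoc]
      _ = m := by rw [hx1, hy1, Matrix.one_mul, Matrix.mul_one]
  rw [← key a, h, key b]

lemma dproj_biact_eq_iff (hP : IsPatternOrder P) {x y : Matrix (Fin n) (Fin n) F}
    (hx : x ∈ patternGroup F P) (hy : y ∈ patternGroup F P) {a b : Matrix (Fin n) (Fin n) F} :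
    dproj P (xᵀ * a * yᵀ) = dproj P (xᵀ * b * yᵀ) ↔ dproj P a = dproj P b := by
  refine ⟨dproj_eq_of_biact_eq hP hx hy, fun h => ?_⟩
  rw [← dproj_transpose_mul_dproj hP hx hy, h, dproj_transpose_mul_dproj hP hx hy]

/-- The order of the stabilizer of `lam` under the left action. -/
def leftStabCard (P : Fin n → Fin n → Prop) (lam : Matrix (Fin n) (Fin n) F) : ℂ :=
  ∑ x ∈ setFinset (patternGroup F P), if dproj P (xᵀ * lam) = dproj P lam then 1 else 0

/-- The order of the stabilizer of `lam` under the two-sided action. -/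
def biStabCard (P : Fin n → Fin n → Prop) (lam : Matrix (Fin n) (Fin n) F) : ℂ :=
  ∑ x ∈ setFinset (patternGroup F P), ∑ y ∈ setFinset (patternGroup F P),
    if dproj P (xᵀ * lam * yᵀ) = dproj P lam then 1 else 0

lemma setFinset_leftOrbit (hP : IsPatternOrder P) (lam : Matrix (Fin n) (Fin n) F) :
    setFinset (leftOrbit F P lam) =
      (setFinset (patternGroup F P)).image fun x => dproj P (xᵀ * lam) := by
  ext m
  simp only [mem_setFinset, Finset.mem_image, leftOrbit, Set.mem_ofPred_eq, lact]
  constructor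
  · rintro ⟨u, hu, rfl⟩
    exact ⟨_, inverse_mem_patternGroup hP hu, rfl⟩
  · rintro ⟨u, hu, rfl⟩
    exact ⟨_, inverse_mem_patternGroup hP hu, by rw [inverse_inverse_of_mem_patternGroup hP hu]⟩

lemma setFinset_biOrbit (hP : IsPatternOrder P) (lam : Matrix (Fin n) (Fin n) F) :
    setFinset (biOrbit F P lam) =
      (setFinset (patternGroup F P) ×ˢ setFinset (patternGroup F P)).image
        fun p => dproj P (p.1ᵀ * lam * p.2ᵀ) := by
  ext m
  simp only [mem_setFinset, Finset.mem_image, biOrbit, Set.mem_ofPred_eq, biact,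
    Finset.mem_product, Prod.exists]
  constructor
  · rintro ⟨u, hu, v, hv, rfl⟩
    exact ⟨_, _, ⟨inverse_mem_patternGroup hP hu, inverse_mem_patternGroup hP hv⟩, rfl⟩
  · rintro ⟨u, v, ⟨hu, hv⟩, rfl⟩
    exact ⟨_, inverse_mem_patternGroup hP hu, _, inverse_mem_patternGroup hP hv,
      by rw [inverse_inverse_of_mem_patternGroup hP hu, inverse_inverse_of_mem_patternGroup hP hv]⟩

lemma card_patternGroup_eq_left (hP : IsPatternOrder P) (lam : Matrix (Fin n) (Fin n) F) :
    ((setFinset (patternGroup F P)).card : ℂ) =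
      leftStabCard P lam * (setFinset (leftOrbit F P lam)).card := by
  have h := sum_comp_eq_mul_sum_image (setFinset (patternGroup F P))
    (fun x => dproj P (xᵀ * lam)) (leftStabCard P lam) ?_ (fun _ => 1)
  · rw [setFinset_leftOrbit hP]
    simpa using h
  · intro g hg
    rw [mem_setFinset] at hg
    rw [← sum_patternGroup_mul_right hP hg]
    refine Finset.sum_congr rfl fun x _ => ?_
    have := dproj_biact_eq_iff hP hg one_mem_patternGroup (a := xᵀ * lam) (b := lam)
    simp only [Matrix.transpose_one, Matrix.mul_one] at this
    simp only [Matrix.transpose_mul, Matrix.mul_assoc, this]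

lemma sum_biact (hP : IsPatternOrder P) (lam : Matrix (Fin n) (Fin n) F)
    (f : Matrix (Fin n) (Fin n) F → ℂ) :
    ∑ x ∈ setFinset (patternGroup F P), ∑ y ∈ setFinset (patternGroup F P),
      f (dproj P (xᵀ * lam * yᵀ)) =
        biStabCard P lam * ∑ m ∈ setFinset (biOrbit F P lam), f m := by
  have h := sum_comp_eq_mul_sum_image
    (setFinset (patternGroup F P) ×ˢ setFinset (patternGroup F P))
    (fun p => dproj P (p.1ᵀ * lam * p.2ᵀ)) (biStabCard P lam) ?_ f
  · rw [setFinset_biOrbit hP, ← h, Finset.sum_product]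
  · rintro ⟨g, k⟩ hg
    simp only [Finset.mem_product, mem_setFinset] at hg
    rw [Finset.sum_product, ← sum_patternGroup_mul_right hP hg.1]
    refine Finset.sum_congr rfl fun x _ => ?_
    rw [← sum_patternGroup_mul_left hP hg.2]
    refine Finset.sum_congr rfl fun y _ => ?_
    have := dproj_biact_eq_iff hP hg.1 hg.2 (a := xᵀ * lam * yᵀ) (b := lam)
    simp only [Matrix.transpose_mul, Matrix.mul_assoc] at this ⊢
    simp only [this]

lemma biStabCard_neg (lam : Matrix (Fin n) (Fin n) F) :
    biStabCard P (-lam) = biStabCard P lam := by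
  simp only [biStabCard, Matrix.mul_neg, Matrix.neg_mul, dproj_neg, neg_inj]

lemma card_patternGroup_ne_zero : ((setFinset (patternGroup F P)).card : ℂ) ≠ 0 := by
  have : (setFinset (patternGroup F P)).card ≠ 0 :=
    Finset.card_ne_zero_of_mem (mem_setFinset.2 one_mem_patternGroup)
  exact_mod_cast this

/-- A supercharacter as an average over the group. -/
lemma superchar_eq_average (hP : IsPatternOrder P) (θ : F → ℂ) (lam : Matrix (Fin n) (Fin n) F)
    {u : Matrix (Fin n) (Fin n) F} (hu : u ∈ patternGroup F P) :
    superchar P θ lam u =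
      (leftStabCard P lam * (setFinset (patternGroup F P)).card)⁻¹ *
        ∑ x ∈ setFinset (patternGroup F P), ∑ y ∈ setFinset (patternGroup F P),
          θ (pairF (-lam) (x * (u - 1) * y)) := by
  have h0 := card_patternGroup_ne_zero (F := F) (P := P)
  have h1 := card_patternGroup_eq_left hP lam
  have h2 := sum_biact hP lam fun _ => 1
  have h3 := sum_biact hP (-lam) fun m => θ (pairF m (u - 1))
  simp only [pairF_dproj hP hu, pairF_transpose_mul, biStabCard_neg] at h3
  rw [h3, superchar]
  simp only [Finset.sum_const, nsmul_eq_mul, mul_one] at h2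
  set U : ℂ := ((setFinset (patternGroup F P)).card : ℂ)
  set L : ℂ := ((setFinset (leftOrbit F P lam)).card : ℂ)
  set B : ℂ := ((setFinset (biOrbit F P lam)).card : ℂ)
  have hs : leftStabCard P lam ≠ 0 := by
    intro h; rw [h, zero_mul] at h1; exact h0 h1
  have hB : B ≠ 0 := by
    intro h; rw [h, mul_zero] at h2; exact mul_ne_zero h0 h0 h2
  rw [← mul_assoc]
  congr 1
  rw [div_eq_iff hB, mul_assoc, ← h2, mul_inv, h1]
  field_simp

lemma superchar_conj (hP : IsPatternOrder P) (θ : F → ℂ) (lam : Matrix (Fin n) (Fin n) F)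
    {u v : Matrix (Fin n) (Fin n) F} (hu : u ∈ patternGroup F P) (hv : v ∈ patternGroup F P) :
    superchar P θ lam (Ring.inverse v * u * v) = superchar P θ lam u := by
  have hv' := inverse_mem_patternGroup hP hv
  rw [superchar_eq_average hP θ lam hu, superchar_eq_average hP θ lam
    (mul_mem_patternGroup hP (mul_mem_patternGroup hP hv' hu) hv)]
  refine congrArg _ ?_
  refine (sum_patternGroup_mul_right hP hv _).symm.trans ?_
  refine Finset.sum_congr rfl fun x _ => ?_
  refine (sum_patternGroup_mul_left hP hv' _).symm.trans ?_
  refine Finset.sum_congr rfl fun y _ => ?_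
  have hvU := isUnit_of_mem_patternGroup hP hv
  have h : Ring.inverse v * u * v - 1 = Ring.inverse v * (u - 1) * v := by
    rw [Matrix.mul_sub, Matrix.sub_mul, Matrix.mul_one, Ring.inverse_mul_cancel _ hvU]
  have h' : x * v * (Ring.inverse v * (u - 1) * v) * (Ring.inverse v * y) =
      x * (v * Ring.inverse v) * (u - 1) * (v * Ring.inverse v) * y := by
    simp only [Matrix.mul_assoc]
  rw [h, h', Ring.mul_inverse_cancel _ hvU, Matrix.mul_one, Matrix.mul_one]

end Orbits

section ArcCharacters

variable {F : Type*} [Field F] {n : ℕ}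

lemma AddChar.map_finset_sum {ι : Type*} (θ : AddChar F ℂ) (s : Finset ι) (f : ι → F) :
    θ (∑ i ∈ s, f i) = ∏ i ∈ s, θ (f i) := by
  induction s using Finset.induction_on with
  | empty => simp
  | insert a s ha ih => rw [Finset.sum_insert ha, Finset.prod_insert ha, AddChar.map_add_eq_mul, ih]

/-- The value `θ((a(u-1))ₖ)` if `a(u-1)` vanishes before column `k`, and `0` otherwise. -/
def colTerm (θ : AddChar F ℂ) (u : Matrix (Fin n) (Fin n) F) (k : Fin n) (a : Fin n → F) : ℂ :=
  if ∀ l, l < k → (a ᵥ* (u - 1)) l = 0 then θ ((a ᵥ* (u - 1)) k) else 0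

lemma sub_one_apply_of_not_lt {u : Matrix (Fin n) (Fin n) F}
    (hu : u ∈ patternGroup F (fun i j : Fin n => i < j)) {i j : Fin n} (h : ¬ i < j) :
    (u - 1) i j = 0 := by
  rw [Matrix.sub_apply, apply_eq_of_mem_patternGroup hu h, sub_self]

lemma vecMul_sub_one_congr {u : Matrix (Fin n) (Fin n) F}
    (hu : u ∈ patternGroup F (fun i j : Fin n => i < j)) {k : Fin n} {a b : Fin n → F}
    (hab : ∀ l, l < k → a l = b l) : (a ᵥ* (u - 1)) k = (b ᵥ* (u - 1)) k := by
  simp only [Matrix.vecMul, dotProduct]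
  refine Finset.sum_congr rfl fun l _ => ?_
  by_cases hl : l < k
  · rw [hab l hl]
  · rw [sub_one_apply_of_not_lt hu hl, mul_zero, mul_zero]

lemma colTerm_congr (θ : AddChar F ℂ) {u : Matrix (Fin n) (Fin n) F}
    (hu : u ∈ patternGroup F (fun i j : Fin n => i < j)) {k : Fin n} {a b : Fin n → F}
    (hab : ∀ l, l < k → a l = b l) : colTerm θ u k a = colTerm θ u k b := by
  have h : ∀ m, m ≤ k → (a ᵥ* (u - 1)) m = (b ᵥ* (u - 1)) m := fun m hm =>
    vecMul_sub_one_congr hu fun l hl => hab l (hl.trans_le hm)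
  unfold colTerm
  rw [h k le_rfl]
  refine if_congr (forall₂_congr fun l hl => ?_) rfl rfl
  rw [h l hl.le]

variable [Fintype F]

/-- The character `1 + ∑ χ^{l ⌢ₜ k}` over the arcs ending in `k` with `i ≤ l`. -/
def columnChar (θ : AddChar F ℂ) (u : Matrix (Fin n) (Fin n) F) (i : ℕ) (k : Fin n) : ℂ :=
  ∑ a ∈ agreeOff (fun l : Fin n => i ≤ l ∧ l < k) 0, colTerm θ u k a

/-- The supercharacter of the single arc `i ⌢ₜ k`. -/
def arcChar (θ : AddChar F ℂ) (u : Matrix (Fin n) (Fin n) F) (i k : Fin n) (t : F) : ℂ :=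
  ∑ a ∈ agreeOff (fun l : Fin n => i < l ∧ l < k) (Pi.single i (-t)), colTerm θ u k a

/-- The contribution of the entry `t` at `(i, k)` to the supercharacter. -/
def arcFactor (θ : AddChar F ℂ) (u : Matrix (Fin n) (Fin n) F) (i k : Fin n) (t : F) : ℂ :=
  if t = 0 then 1 else arcChar θ u i k t

variable {P : Fin n → Fin n → Prop} {lam : Matrix (Fin n) (Fin n) F}

lemma leftStabCard_eq_prod (hP : IsPatternOrder P)
    (hint : ∀ i k j, P i j → i < k → k < j → P i k ∧ P k j)
    (hsupp : ∀ i j, lam i j ≠ 0 → P i j)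
    (hcol : ∀ i i' j, lam i j ≠ 0 → lam i' j ≠ 0 → i = i') :
    leftStabCard P lam = ∏ i,
      ((agreeOff (fun k => P i k ∧ ∀ j, lam i j ≠ 0 → ¬ k < j)
        (Pi.single i (1 : F))).card : ℂ) := by
  have hrows : ∀ i : Fin n,
      ((agreeOff (fun k => P i k ∧ ∀ j, lam i j ≠ 0 → ¬ k < j) (Pi.single i (1 : F))).card : ℂ) =
      ∑ r ∈ agreeOff (P i) (Pi.single i (1 : F)),
        if r ∈ agreeOff (fun k => P i k ∧ ∀ j, lam i j ≠ 0 → ¬ k < j) (Pi.single i (1 : F))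
        then 1 else 0 := by
    intro i
    rw [Finset.sum_boole, Finset.filter_mem_eq_inter, Finset.inter_eq_right.2]
    intro r hr
    rw [mem_agreeOff] at hr ⊢
    exact fun k hk => hr k fun h => hk h.1
  rw [Finset.prod_congr rfl fun i _ => hrows i, ← sum_patternGroup_prod_rows hP, leftStabCard]
  refine Finset.sum_congr rfl fun x hx => ?_
  rw [mem_setFinset] at hx
  rw [Finset.prod_boole]
  have hxz : ∀ {i k}, i ≠ k → ¬ P i k → x i k = 0 := fun h hp => by
    rw [apply_eq_of_mem_patternGroup hx hp, Matrix.one_apply_ne h]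
  have hsum : ∀ i j k, lam i j ≠ 0 → (xᵀ * lam) k j = x i k * lam i j := by
    intro i j k hij
    rw [Matrix.mul_apply, Finset.sum_eq_single i]
    · rfl
    · intro l _ hl
      by_cases hlj : lam l j = 0
      · rw [hlj, mul_zero]
      · exact absurd (hcol _ _ _ hlj hij) hl
    · simp
  have hiff : dproj P (xᵀ * lam) = dproj P lam ↔ ∀ i ∈ Finset.univ,
      (fun j => x i j) ∈ agreeOff (fun k => P i k ∧ ∀ j, lam i j ≠ 0 → ¬ k < j)
        (Pi.single i (1 : F)) := by
    refine ⟨fun h i _ => ?_, fun h => ?_⟩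
    · rw [mem_agreeOff]
      intro k hk
      by_cases hik : P i k
      · have : ∃ j, lam i j ≠ 0 ∧ k < j := by
          by_contra! hj
          exact hk ⟨hik, fun j h1 => not_lt.2 (hj j h1)⟩
        obtain ⟨j, hij, hkj⟩ := this
        have hlt := hP.1 _ _ hik
        have he := congrFun (congrFun h k) j
        have hk0 : lam k j = 0 := by
          by_contra h0
          exact hlt.ne (hcol _ _ _ hij h0)
        simp only [dproj, Matrix.of_apply, if_pos (hint i k j (hsupp _ _ hij) hlt hkj).2,
          hsum i j k hij, hk0] at he
        rw [Pi.single_eq_of_ne hlt.ne']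
        exact (mul_eq_zero.1 he).resolve_right hij
      · rw [apply_eq_of_mem_patternGroup hx hik, Matrix.one_eq_pi_single]
    · ext k j
      simp only [dproj, Matrix.of_apply]
      split_ifs with hkj
      · by_cases hc : ∃ i, lam i j ≠ 0
        · obtain ⟨i, hij⟩ := hc
          rw [hsum i j k hij]
          rcases eq_or_ne i k with rfl | hik
          · rw [hx.1, one_mul]
          · have hk0 : lam k j = 0 := by
              by_contra h0
              exact hik (hcol _ _ _ hij h0)
            have hxk : x i k = 0 := by
              by_cases hp : P i k
              · have := mem_agreeOff.1 (h i (Finset.mem_univ _)) k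
                  fun hh => hh.2 j hij (hP.1 _ _ hkj)
                rwa [Pi.single_eq_of_ne hik.symm] at this
              · exact hxz hik hp
            rw [hxk, hk0, zero_mul]
        · push Not at hc
          rw [Matrix.mul_apply, hc k]
          exact Finset.sum_eq_zero fun i _ => by rw [hc i, mul_zero]
      · rfl
  by_cases h : dproj P (xᵀ * lam) = dproj P lam
  · rw [if_pos h, if_pos (hiff.1 h)]
  · rw [if_neg h, if_neg fun h' => h (hiff.2 h')]

/-- The contribution of the entry `(i, j)` of `lam` to the sum over the rows of the group, as a
function of the row vector `w`. -/
def entryTerm (θ : AddChar F ℂ) (P : Fin n → Fin n → Prop) (j : Fin n) (t : F)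
    (w : Fin n → F) : ℂ :=
  if t = 0 then 1 else if ∀ k, P k j → w k = 0 then θ (-t * w j) else 0

lemma sum_col_entries {θ : AddChar F ℂ} (hθ : ∃ a, θ a ≠ 1)
    (hcol : ∀ i i' j, lam i j ≠ 0 → lam i' j ≠ 0 → i = i') (j : Fin n)
    (w : Fin n → Fin n → F) :
    ∑ c ∈ agreeOff (P · j) (Pi.single j (1 : F)), ∏ i, θ ((-lam i j • w i) ⬝ᵥ c) =
      ((agreeOff (P · j) (Pi.single j (1 : F))).card : ℂ) *
        ∏ i, entryTerm θ P j (lam i j) (w i) := by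
  by_cases hc : ∃ i, lam i j ≠ 0
  · obtain ⟨i, hij⟩ := hc
    have h0 : ∀ l, l ≠ i → lam l j = 0 := fun l hl => by
      by_contra h
      exact hl (hcol _ _ _ h hij)
    have h1 : ∀ c : Fin n → F, ∏ l, θ ((-lam l j • w l) ⬝ᵥ c) = θ ((-lam i j • w i) ⬝ᵥ c) :=
      fun c => Finset.prod_eq_single i (fun l _ hl => by simp [h0 l hl]) (by simp)
    have h2 : ∏ l, entryTerm θ P j (lam l j) (w l) = entryTerm θ P j (lam i j) (w i) :=
      Finset.prod_eq_single i (fun l _ hl => by simp [h0 l hl, entryTerm]) (by simp)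
    simp only [h1, h2]
    rw [sum_agreeOff_addChar hθ, entryTerm, if_neg hij, mul_ite, mul_zero, dotProduct_single,
      mul_one]
    refine if_congr (forall₂_congr fun k _ => ?_) rfl rfl
    simp [hij]
  · push Not at hc
    simp [hc, entryTerm]

lemma sum_row_entries (θ : AddChar F ℂ) (hP : IsPatternOrder P)
    (hint : ∀ i k j, P i j → i < k → k < j → P i k ∧ P k j)
    (hsupp : ∀ i j, lam i j ≠ 0 → P i j)
    (hrow : ∀ i j j', lam i j ≠ 0 → lam i j' ≠ 0 → j = j')
    {u : Matrix (Fin n) (Fin n) F} (hu : u ∈ patternGroup F (fun i j : Fin n => i < j))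
    (i : Fin n) :
    ∑ r ∈ agreeOff (P i) (Pi.single i (1 : F)),
        ∏ j, entryTerm θ P j (lam i j) (r ᵥ* (u - 1)) =
      ((agreeOff (fun k => P i k ∧ ∀ j, lam i j ≠ 0 → ¬ k < j)
        (Pi.single i (1 : F))).card : ℂ) * ∏ j, arcFactor θ u i j (lam i j) := by
  by_cases hc : ∃ j, lam i j ≠ 0
  · obtain ⟨j, hij⟩ := hc
    have hpij := hsupp _ _ hij
    have hlt := hP.1 _ _ hpij
    have h0 : ∀ l, l ≠ j → lam i l = 0 := fun l hl => by
      by_contra h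
      exact hl (hrow _ _ _ h hij)
    have h1 : ∀ r : Fin n → F, ∏ l, entryTerm θ P l (lam i l) r = entryTerm θ P j (lam i j) r :=
      fun r => Finset.prod_eq_single j (fun l _ hl => by simp [h0 l hl, entryTerm]) (by simp)
    have h2 : ∏ l, arcFactor θ u i l (lam i l) = arcFactor θ u i j (lam i j) :=
      Finset.prod_eq_single j (fun l _ hl => by simp [h0 l hl, arcFactor]) (by simp)
    have h3 : (fun k => P i k ∧ ∀ j, lam i j ≠ 0 → ¬ k < j) = fun k => P i k ∧ ¬ k < j := by
      ext k
      refine and_congr_right fun _ => ⟨fun h => h j hij, fun h l hl => ?_⟩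
      rwa [hrow _ _ _ hl hij]
    simp only [h1, h2, h3]
    rw [arcFactor, if_neg hij, arcChar, ← nsmul_eq_mul, ← Finset.sum_const,
      ← Finset.sum_product']
    set t := lam i j
    refine Finset.sum_nbij' (fun r => ((fun l => if l < j then (Pi.single i 1 : Fin n → F) l else r l,
      fun l => if l < j then -t * r l else 0) : (Fin n → F) × (Fin n → F)))
      (fun p l => if l < j then -p.2 l / t else p.1 l) ?_ ?_ ?_ ?_ ?_
    · intro r hr
      rw [mem_agreeOff] at hr
      simp only [Finset.mem_product, mem_agreeOff]
      refine ⟨fun l hl => ?_, fun l hl => ?_⟩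
      · split_ifs with hlj
        · rfl
        · exact hr l fun h => hl ⟨h, hlj⟩
      · split_ifs with hlj
        · rw [hr l fun h => hl ⟨hP.1 _ _ h, hlj⟩]
          rcases eq_or_ne l i with rfl | hli
          · simp
          · simp [hli]
        · rw [Pi.single_eq_of_ne]
          rintro rfl
          exact hlj hlt
    · rintro ⟨s, a⟩ hp
      simp only [Finset.mem_product, mem_agreeOff] at hp
      rw [mem_agreeOff]
      intro l hl
      dsimp only
      split_ifs with hlj
      · rw [hp.2 l fun h => hl (hint i l j hpij h.1 hlj).1]
        rcases eq_or_ne l i with rfl | hli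
        · simp [hij]
        · simp [hli]
      · exact hp.1 l fun h => hl h.1
    · intro r _
      ext l
      dsimp only
      split_ifs with hlj
      · field_simp
      · rfl
    · rintro ⟨s, a⟩ hp
      simp only [Finset.mem_product, mem_agreeOff] at hp
      refine Prod.ext (funext fun l => ?_) (funext fun l => ?_)
      · dsimp only
        split_ifs with hlj
        · exact (hp.1 l fun h => h.2 hlj).symm
        · rfl
      · dsimp only
        split_ifs with hlj
        · field_simp
        · rw [hp.2 l fun h => hlj h.2, Pi.single_eq_of_ne]
          rintro rfl
          exact hlj hlt
    · intro r hr
      rw [mem_agreeOff] at hr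
      have hc : colTerm θ u j (fun l => if l < j then -t * r l else 0) =
          colTerm θ u j (-t • r) :=
        colTerm_congr θ hu fun l hl => by simp [hl]
      rw [hc, entryTerm, if_neg hij, colTerm]
      simp only [Matrix.smul_vecMul, Pi.smul_apply, smul_eq_mul, mul_eq_zero, neg_eq_zero, hij,
        false_or]
      have hiff : (∀ k, P k j → (r ᵥ* (u - 1)) k = 0) ↔
          ∀ k, k < j → (r ᵥ* (u - 1)) k = 0 := by
        refine ⟨fun h k hk => ?_, fun h k hk => h k (hP.1 _ _ hk)⟩
        by_cases hik : i < k
        · exact h k (hint i k j hpij hik hk).2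
        · simp only [Matrix.vecMul, dotProduct]
          refine Finset.sum_eq_zero fun l _ => ?_
          by_cases hlk : l < k
          · have hli : l < i := hlk.trans_le (not_lt.1 hik)
            rw [hr l fun h => lt_asymm (hP.1 _ _ h) hli, Pi.single_eq_of_ne hli.ne, zero_mul]
          · rw [sub_one_apply_of_not_lt hu hlk, mul_zero]
      simp only [hiff]
  · push Not at hc
    simp [hc, arcFactor, entryTerm]

lemma superchar_eq_prod {θ : AddChar F ℂ} (hθ : ∃ a, θ a ≠ 1) (hP : IsPatternOrder P)
    (hint : ∀ i k j, P i j → i < k → k < j → P i k ∧ P k j)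
    (hsupp : ∀ i j, lam i j ≠ 0 → P i j)
    (hrow : ∀ i j j', lam i j ≠ 0 → lam i j' ≠ 0 → j = j')
    (hcol : ∀ i i' j, lam i j ≠ 0 → lam i' j ≠ 0 → i = i')
    {u : Matrix (Fin n) (Fin n) F} (hu : u ∈ patternGroup F P) :
    superchar P θ lam u = ∏ i, ∏ j, arcFactor θ u i j (lam i j) := by
  have hu' : u ∈ patternGroup F (fun i j : Fin n => i < j) :=
    ⟨hu.1, fun i j hij h => hP.1 _ _ (hu.2 i j hij h)⟩
  have hcard : ((setFinset (patternGroup F P)).card : ℂ) =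
      ∏ j, ((agreeOff (P · j) (Pi.single j (1 : F))).card : ℂ) := by
    simpa using sum_patternGroup_prod_cols (F := F) hP fun _ _ => 1
  have hpair : ∀ x y : Matrix (Fin n) (Fin n) F, θ (pairF (-lam) (x * (u - 1) * y)) =
      ∏ j, ∏ i, θ ((-lam i j • (x i ᵥ* (u - 1))) ⬝ᵥ fun k => y k j) := by
    intro x y
    simp only [← AddChar.map_finset_sum]
    rw [pairF, Finset.sum_comm]
    congr 1
    refine Finset.sum_congr rfl fun j _ => Finset.sum_congr rfl fun i _ => ?_
    rw [smul_dotProduct, smul_eq_mul]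
    rfl
  have hsum : ∑ x ∈ setFinset (patternGroup F P), ∑ y ∈ setFinset (patternGroup F P),
      θ (pairF (-lam) (x * (u - 1) * y)) =
        (setFinset (patternGroup F P)).card * (leftStabCard P lam *
          ∏ i, ∏ j, arcFactor θ u i j (lam i j)) := by
    rw [leftStabCard_eq_prod hP hint hsupp hcol, ← Finset.prod_mul_distrib,
      ← Finset.prod_congr rfl fun i _ => sum_row_entries θ hP hint hsupp hrow hu' i,
      ← sum_patternGroup_prod_rows hP, Finset.mul_sum]
    refine Finset.sum_congr rfl fun x _ => ?_
    simp only [hpair]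
    rw [sum_patternGroup_prod_cols hP
      (fun j c => ∏ i, θ ((-lam i j • (x i ᵥ* (u - 1))) ⬝ᵥ c)),
      Finset.prod_congr rfl fun j _ => sum_col_entries hθ hcol j fun i => x i ᵥ* (u - 1),
      Finset.prod_mul_distrib, ← hcard, Finset.prod_comm]
  rw [superchar_eq_average hP θ lam hu, hsum, mul_inv]
  have h0 := card_patternGroup_ne_zero (F := F) (P := P)
  have h1 : leftStabCard P lam ≠ 0 := by
    intro h
    have := card_patternGroup_eq_left hP lam
    rw [h, zero_mul] at this
    exact h0 this
  field_simp

end ArcCharacters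

section StarProduct

variable {F : Type*} [Field F] {n : ℕ}

/-- `mu` encodes a labeled set partition of `{1, …, n}`. -/
structure IsLabeledPartition (n : ℕ) (mu : SPF F) : Prop where
  supp : ∀ i j, mu i j ≠ 0 → 1 ≤ i ∧ i < j ∧ j ≤ n
  row : ∀ i j j', mu i j ≠ 0 → mu i j' ≠ 0 → j = j'
  col : ∀ i i' j, mu i j ≠ 0 → mu i' j ≠ 0 → i = i'

lemma IsLabeledPartition.erase {mu : SPF F} (h : IsLabeledPartition n mu) (i j : ℕ) :
    IsLabeledPartition n (updArc mu i j 0) := by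
  have key : ∀ a b, updArc mu i j 0 a b ≠ 0 → mu a b ≠ 0 := fun a b hab => by
    unfold updArc at hab
    split_ifs at hab with hc
    · exact absurd rfl hab
    · exact hab
  exact ⟨fun a b h1 => h.supp a b (key _ _ h1),
    fun a b c h1 h2 => h.row a b c (key _ _ h1) (key _ _ h2),
    fun a b c h1 h2 => h.col a b c (key _ _ h1) (key _ _ h2)⟩

lemma IsLabeledPartition.adjoin {mu : SPF F} (h : IsLabeledPartition n mu) {i k : ℕ}
    (hi : 1 ≤ i) (hik : i < k) (hk : k ≤ n) (hrow : ∀ b, mu i b = 0) (hcol : ∀ a, mu a k = 0)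
    (t : F) : IsLabeledPartition n (updArc mu i k t) := by
  have key : ∀ a b, updArc mu i k t a b ≠ 0 → (a = i ∧ b = k) ∨ (mu a b ≠ 0 ∧ a ≠ i ∧ b ≠ k) := by
    intro a b hab
    unfold updArc at hab
    split_ifs at hab with hc
    · exact Or.inl hc
    · refine Or.inr ⟨hab, ?_, ?_⟩
      · rintro rfl
        exact hab (hrow b)
      · rintro rfl
        exact hab (hcol a)
  refine ⟨fun a b h1 => ?_, fun a b c h1 h2 => ?_, fun a b c h1 h2 => ?_⟩
  · rcases key _ _ h1 with ⟨rfl, rfl⟩ | ⟨h3, -⟩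
    · exact ⟨hi, hik, hk⟩
    · exact h.supp _ _ h3
  · rcases key _ _ h1 with h3 | h3 <;> rcases key _ _ h2 with h4 | h4
    · exact h3.2.trans h4.2.symm
    · exact absurd h3.1 h4.2.1
    · exact absurd h4.1 h3.2.1
    · exact h.row _ _ _ h3.1 h4.1
  · rcases key _ _ h1 with h3 | h3 <;> rcases key _ _ h2 with h4 | h4
    · exact h3.1.trans h4.1.symm
    · exact absurd h3.2 h4.2.2
    · exact absurd h4.2 h3.2.2
    · exact h.col _ _ _ h3.1 h4.1

variable [Fintype F]

lemma columnChar_eq_sum_arcChar (θ : AddChar F ℂ) (u : Matrix (Fin n) (Fin n) F) {i k : Fin n}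
    (hik : i < k) : columnChar θ u i k = ∑ t, arcChar θ u i k t := by
  rw [columnChar, ← Finset.sum_fiberwise _ (fun a => -a i)]
  refine Finset.sum_congr rfl fun t _ => Finset.sum_congr ?_ fun _ _ => rfl
  ext a
  simp only [Finset.mem_filter, mem_agreeOff]
  constructor
  · rintro ⟨h, rfl⟩ l hl
    rcases eq_or_ne l i with rfl | hli
    · simp
    · rw [Pi.single_eq_of_ne hli]
      refine h l fun hh => hl ⟨lt_of_le_of_ne hh.1 hli.symm, hh.2⟩
  · intro h
    refine ⟨fun l hl => ?_, ?_⟩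
    · rw [h l fun hh => hl ⟨hh.1.le, hh.2⟩, Pi.single_eq_of_ne, Pi.zero_apply]
      rintro rfl
      exact hl ⟨le_rfl, hik⟩
    · rw [h i fun hh => lt_irrefl _ hh.1]
      simp

lemma arcChar_zero (θ : AddChar F ℂ) (u : Matrix (Fin n) (Fin n) F) (i k : Fin n) :
    arcChar θ u i k 0 = columnChar θ u (i + 1) k := by
  rw [arcChar, columnChar, neg_zero, Pi.single_zero]
  rfl

lemma columnChar_step (θ : AddChar F ℂ) (u : Matrix (Fin n) (Fin n) F) {i k : Fin n}
    (hik : i < k) : columnChar θ u i k = columnChar θ u (i + 1) k +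
      ∑ t ∈ Finset.univ.filter (fun t : F => t ≠ 0), arcChar θ u i k t := by
  rw [columnChar_eq_sum_arcChar θ u hik, ← arcChar_zero, Finset.filter_ne',
    Finset.add_sum_erase _ _ (Finset.mem_univ _)]

lemma columnChar_self (θ : AddChar F ℂ) (u : Matrix (Fin n) (Fin n) F) (k : Fin n) :
    columnChar θ u k k = 1 := by
  have : agreeOff (fun l : Fin n => (k : ℕ) ≤ l ∧ l < k) (0 : Fin n → F) = {0} := by
    ext a
    rw [mem_agreeOff, Finset.mem_singleton, funext_iff]
    exact forall_congr' fun l => ⟨fun h => h fun hh => absurd hh.1 (not_le.2 hh.2), fun h _ => h⟩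
  rw [columnChar, this, Finset.sum_singleton]
  simp [colTerm]

/-- Two arcs leaving the same point: the shorter one resolves into a column character. -/
lemma arcChar_mul_arcChar (θ : AddChar F ℂ) {u : Matrix (Fin n) (Fin n) F}
    (hu : u ∈ patternGroup F (fun i j : Fin n => i < j)) {i k l : Fin n} (hik : i < k)
    (hkl : k < l) {t : F} (ht : t ≠ 0) (s : F) :
    arcChar θ u i l t * arcChar θ u i k s = arcChar θ u i l t * columnChar θ u (i + 1) k := by
  by_cases h0 : arcChar θ u i l t = 0
  · rw [h0, zero_mul, zero_mul]
  congr 1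
  obtain ⟨a, ha, h1⟩ := Finset.exists_ne_zero_of_sum_ne_zero h0
  rw [mem_agreeOff] at ha
  have hav : ∀ m, m < l → (a ᵥ* (u - 1)) m = 0 := by
    by_contra h
    exact h1 (by rw [colTerm, if_neg h])
  set b : Fin n → F := fun m => if m < k then (s / t) * a m else 0 with hb
  have hbv : ∀ m, m ≤ k → (b ᵥ* (u - 1)) m = 0 := by
    intro m hm
    rw [vecMul_sub_one_congr hu (b := (s / t) • a) fun j hj => by simp [hb, hj.trans_le hm],
      Matrix.smul_vecMul, Pi.smul_apply, hav m (hm.trans_lt hkl), smul_zero]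
  have hbm : b ∈ agreeOff (fun m : Fin n => i < m ∧ m < k) (Pi.single i (-s)) := by
    rw [mem_agreeOff]
    intro m hm
    by_cases hmk : m < k
    · rw [hb]
      dsimp only
      rw [if_pos hmk, ha m fun h => hm ⟨h.1, hmk⟩]
      rcases eq_or_ne m i with rfl | hmi
      · simp [ht]
      · simp [hmi]
    · rw [hb]
      dsimp only
      rw [if_neg hmk, Pi.single_eq_of_ne]
      rintro rfl
      exact hmk hik
  rw [← arcChar_zero, arcChar, arcChar, sum_agreeOff_translate hbm, neg_zero, Pi.single_zero]
  refine Finset.sum_congr rfl fun c _ => ?_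
  have hv : ∀ m, m ≤ k → ((b + c) ᵥ* (u - 1)) m = (c ᵥ* (u - 1)) m := fun m hm => by
    rw [Matrix.add_vecMul, Pi.add_apply, hbv m hm, zero_add]
  unfold colTerm
  rw [hv k le_rfl]
  refine if_congr (forall₂_congr fun m hm => ?_) rfl rfl
  rw [hv m hm.le]

/-- The product of the factors of all entries of `lam`. -/
def arcProd (θ : AddChar F ℂ) (u lam : Matrix (Fin n) (Fin n) F) : ℂ :=
  ∏ i, ∏ j, arcFactor θ u i j (lam i j)

lemma arcProd_eq_mul (θ : AddChar F ℂ) (u : Matrix (Fin n) (Fin n) F)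
    {A B : Matrix (Fin n) (Fin n) F} (i j : Fin n)
    (hAB : ∀ a b, (a, b) ≠ (i, j) → A a b = B a b) (hB : B i j = 0) :
    arcProd θ u A = arcFactor θ u i j (A i j) * arcProd θ u B := by
  simp only [arcProd]
  rw [← Fintype.prod_prod_type' (f := fun a b => arcFactor θ u a b (A a b)),
    ← Fintype.prod_prod_type' (f := fun a b => arcFactor θ u a b (B a b)),
    Fintype.prod_eq_mul_prod_compl (i, j), Fintype.prod_eq_mul_prod_compl (i, j)]
  have hone : arcFactor θ u i j (B i j) = 1 := by rw [hB, arcFactor, if_pos rfl]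
  rw [hone, one_mul]
  congr 1
  refine Finset.prod_congr rfl fun p hp => ?_
  rw [hAB p.1 p.2 (by simpa using hp)]

lemma arcProd_updArc (θ : AddChar F ℂ) (u : Matrix (Fin n) (Fin n) F) (mu : SPF F) (i j : Fin n)
    (h : mu (i + 1) (j + 1) = 0) {t : F} (ht : t ≠ 0) :
    arcProd θ u (toMat F n (updArc mu (i + 1) (j + 1) t)) =
      arcChar θ u i j t * arcProd θ u (toMat F n mu) := by
  rw [arcProd_eq_mul θ u (B := toMat F n mu) i j, arcFactor]
  · simp [toMat, updArc, ht]
  · intro a b hab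
    simp only [toMat, updArc, Matrix.of_apply]
    rw [if_neg]
    rintro ⟨h1, h2⟩
    exact hab (Prod.ext (Fin.ext (by simpa using h1)) (Fin.ext (by simpa using h2)))
  · exact h

lemma arcProd_erase (θ : AddChar F ℂ) (u : Matrix (Fin n) (Fin n) F) (mu : SPF F) (i j : Fin n)
    (h : mu (i + 1) (j + 1) ≠ 0) :
    arcProd θ u (toMat F n mu) = arcChar θ u i j (mu (i + 1) (j + 1)) *
      arcProd θ u (toMat F n (updArc mu (i + 1) (j + 1) 0)) := by
  rw [arcProd_eq_mul θ u (B := toMat F n (updArc mu (i + 1) (j + 1) 0)) i j, arcFactor]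
  · simp [toMat, h]
  · intro a b hab
    simp only [toMat, updArc, Matrix.of_apply]
    rw [if_neg]
    rintro ⟨h1, h2⟩
    exact hab (Prod.ext (Fin.ext (by simpa using h1)) (Fin.ext (by simpa using h2)))
  · simp [toMat, updArc]

section Linearity

variable (P : Fin n → Fin n → Prop) (θ : F → ℂ) (g : Matrix (Fin n) (Fin n) F)

lemma charOfComb_add (c d : SPF F →₀ ℂ) :
    charOfComb P θ (c + d) g = charOfComb P θ c g + charOfComb P θ d g :=
  Finsupp.sum_add_index' (fun _ => zero_mul _) fun _ _ _ => add_mul _ _ _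

lemma charOfComb_zero : charOfComb P θ 0 g = 0 :=
  Finsupp.sum_zero_index

lemma charOfComb_sum {ι : Type*} (s : Finset ι) (c : ι → SPF F →₀ ℂ) :
    charOfComb P θ (∑ t ∈ s, c t) g = ∑ t ∈ s, charOfComb P θ (c t) g :=
  map_sum (⟨⟨fun c => charOfComb P θ c g, charOfComb_zero P θ g⟩,
    fun c d => charOfComb_add P θ g c d⟩ : (SPF F →₀ ℂ) →+ ℂ) c s

lemma charOfComb_nsmul (m : ℕ) (c : SPF F →₀ ℂ) :
    charOfComb P θ (m • c) g = m * charOfComb P θ c g := by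
  rw [← nsmul_eq_mul]
  exact map_nsmul (⟨⟨fun c => charOfComb P θ c g, charOfComb_zero P θ g⟩,
    fun c d => charOfComb_add P θ g c d⟩ : (SPF F →₀ ℂ) →+ ℂ) m c

lemma charOfComb_single (mu : SPF F) :
    charOfComb P θ (Finsupp.single mu 1) g = superchar P θ (toMat F n mu) g := by
  rw [charOfComb, Finsupp.sum_single_index (zero_mul _), one_mul]

end Linearity

lemma isPatternOrder_lt : IsPatternOrder (fun i j : Fin n => i < j) :=
  ⟨fun _ _ h => h, fun _ _ _ h h' => h.trans h'⟩

lemma superchar_toMat {θ : AddChar F ℂ} (hθ : ∃ a, θ a ≠ 1) {P : Fin n → Fin n → Prop}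
    (hP : IsPatternOrder P) (hint : ∀ i k j, P i j → i < k → k < j → P i k ∧ P k j)
    {mu : SPF F} (hmu : IsLabeledPartition n mu)
    (hsupp : ∀ i j : Fin n, mu (i + 1) (j + 1) ≠ 0 → P i j)
    {g : Matrix (Fin n) (Fin n) F} (hg : g ∈ patternGroup F P) :
    superchar P θ (toMat F n mu) g = arcProd θ g (toMat F n mu) := by
  refine superchar_eq_prod hθ hP hint hsupp ?_ ?_ hg
  · intro i j j' h h'
    exact Fin.ext (by simpa using hmu.row _ _ _ h h')
  · intro i i' j h h'
    exact Fin.ext (by simpa using hmu.col _ _ _ h h')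

lemma superchar_lt_toMat {θ : AddChar F ℂ} (hθ : ∃ a, θ a ≠ 1) {mu : SPF F}
    (hmu : IsLabeledPartition n mu) {g : Matrix (Fin n) (Fin n) F}
    (hg : g ∈ patternGroup F (fun i j : Fin n => i < j)) :
    superchar (fun i j : Fin n => i < j) θ (toMat F n mu) g = arcProd θ g (toMat F n mu) :=
  superchar_toMat hθ isPatternOrder_lt (fun _ _ _ _ h h' => ⟨h, h'⟩) hmu
    (fun i j h => by simpa using (hmu.supp _ _ h).2.1) hg

lemma charOfComb_lstar {θ : AddChar F ℂ} (hθ : ∃ a, θ a ≠ 1) {g : Matrix (Fin n) (Fin n) F}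
    (hg : g ∈ patternGroup F (fun i j : Fin n => i < j)) :
    ∀ (d i : ℕ) (k : Fin n) (mu : SPF F), i + d = k → IsLabeledPartition n mu →
      (∀ a, mu a (k + 1) = 0) →
      charOfComb (fun i j : Fin n => i < j) θ (lstar (i + 1) (k + 1) mu) g =
        arcProd θ g (toMat F n mu) * columnChar θ g i k := by
  intro d
  induction d using Nat.strong_induction_on with
  | _ d ih =>
  intro i k mu hd hmu hk
  rcases Nat.eq_zero_or_pos d with rfl | hdpos
  · obtain rfl : i = k := by simpa using hd
    rw [lstar, dif_pos le_rfl, if_pos rfl, charOfComb_single, columnChar_self, mul_one,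
      superchar_lt_toMat hθ hmu hg]
  have hik : i < k := by omega
  obtain ⟨i, rfl⟩ : ∃ i' : Fin n, (i' : ℕ) = i := ⟨⟨i, hik.trans k.2⟩, rfl⟩
  have hik' : i < k := hik
  have ih1 := ih (d - 1) (by omega) (i + 1) k mu (by omega) hmu hk
  rw [lstar, dif_neg (by omega), columnChar_step θ g hik', mul_add]
  split_ifs with h2 h3 h4
  · obtain ⟨l, hl, hil⟩ := h2
    have hln := (hmu.supp _ _ hil).2.2
    obtain ⟨l, rfl⟩ : ∃ l' : Fin n, (l' : ℕ) + 1 = l := ⟨⟨l - 1, by omega⟩, by simp; omega⟩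
    have hkl : k < l := by rw [Fin.lt_def]; omega
    rw [charOfComb_nsmul, ih1, arcProd_erase θ g mu i l hil, Finset.mul_sum]
    have h5 : ∀ t : F, arcChar θ g i l (mu (i + 1) (l + 1)) *
          arcProd θ g (toMat F n (updArc mu (i + 1) (l + 1) 0)) * arcChar θ g i k t =
        arcChar θ g i l (mu (i + 1) (l + 1)) *
          arcProd θ g (toMat F n (updArc mu (i + 1) (l + 1) 0)) * columnChar θ g (i + 1) k := by
      intro t
      rw [mul_right_comm, arcChar_mul_arcChar θ hg hik' hkl hil, mul_right_comm]
    rw [Finset.sum_congr rfl fun t _ => h5 t, Finset.sum_const, Finset.filter_ne',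
      Finset.card_erase_of_mem (Finset.mem_univ _), Finset.card_univ, nsmul_eq_mul,
      Nat.cast_sub Fintype.card_pos, Nat.cast_one]
    ring
  · exact absurd (hk _) h3
  · obtain ⟨hj, hij⟩ := Classical.choose_spec h4
    set j := Classical.choose h4
    have hsj := hmu.supp _ _ hij
    obtain ⟨j', hj'⟩ : ∃ j' : Fin n, (j' : ℕ) + 1 = j := ⟨⟨j - 1, by omega⟩, by simp; omega⟩
    rw [← hj'] at hij hj hsj ⊢
    have hij' : i < j' := by rw [Fin.lt_def]; omega
    have hjk : j' < k := by rw [Fin.lt_def]; omega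
    have hrow : ∀ b, updArc mu (i + 1) (j' + 1) 0 (i + 1) b = 0 := by
      intro b
      by_contra hb
      by_cases hbj : b = j' + 1
      · exact hb (by simp [updArc, hbj])
      · refine hbj (hmu.row _ _ _ ?_ hij)
        simpa [updArc, hbj] using hb
    have hcol : ∀ a, updArc mu (i + 1) (j' + 1) 0 a (k + 1) = 0 := by
      intro a
      unfold updArc
      split_ifs
      · rfl
      · exact hk a
    rw [charOfComb_add, charOfComb_sum, ih1, Finset.mul_sum]
    congr 1
    refine Finset.sum_congr rfl fun t ht => ?_
    have ht : t ≠ 0 := by simpa using ht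
    rw [ih (j' - (i + 1)) (by omega) (i + 1) j' _ (by omega)
      ((hmu.erase _ _).adjoin (by omega) (by omega) k.2 hrow hcol t), arcProd_updArc θ g _ i k
      (hcol _) ht, arcProd_erase θ g mu i j' hij]
    · have := arcChar_mul_arcChar θ hg hij' hjk ht (mu (i + 1) (j' + 1))
      linear_combination -arcProd θ g (toMat F n (updArc mu (i + 1) (j' + 1) 0)) * this
    · intro a
      by_cases ha : a = i + 1
      · subst ha
        simp [updArc, hjk.ne, Fin.val_inj]
      · by_contra h
        refine ha (hmu.col _ _ _ ?_ hij)
        simpa [updArc, ha] using h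
  · have hrow : ∀ b, mu (i + 1) b = 0 := by
      intro b
      by_contra hb
      rcases lt_trichotomy b (k + 1) with h | h | h
      · exact h4 ⟨b, h, hb⟩
      · exact hb (by rw [h]; exact hk _)
      · exact h2 ⟨b, h, hb⟩
    rw [charOfComb_add, charOfComb_sum, ih1, Finset.mul_sum]
    congr 1
    refine Finset.sum_congr rfl fun t ht => ?_
    have ht : t ≠ 0 := by simpa using ht
    rw [charOfComb_single, superchar_lt_toMat hθ
      (hmu.adjoin (by omega) (by omega) k.2 hrow hk t) hg,
      arcProd_updArc θ g mu i k (hk _) ht, mul_comm]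

end StarProduct

section Induction

variable {F : Type*} [Field F] [Fintype F] {n : ℕ}

lemma card_fixed_columns {θ : AddChar F ℂ} (hθ : ∃ a, θ a ≠ 1) {g : Matrix (Fin n) (Fin n) F}
    (hg : g ∈ patternGroup F (fun i j : Fin n => i < j)) (k : Fin n) :
    ∑ c ∈ agreeOff (· < k) (Pi.single k (1 : F)), (if (g - 1) *ᵥ c = 0 then (1 : ℂ) else 0) =
      columnChar θ g 0 k := by
  have hcard : ((agreeOff (fun l : Fin n => 0 ≤ (l : ℕ) ∧ l < k) (0 : Fin n → F)).card : ℂ) =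
      (agreeOff (· < k) (Pi.single k (1 : F))).card := by
    rw [card_agreeOff (· < k)]
    simp only [Nat.zero_le, true_and]
  have h1 : ∀ a : Fin n → F,
      ∑ c ∈ agreeOff (· < k) (Pi.single k (1 : F)), θ ((a ᵥ* (g - 1)) ⬝ᵥ c) =
        (agreeOff (· < k) (Pi.single k (1 : F))).card * colTerm θ g k a := by
    intro a
    rw [sum_agreeOff_addChar hθ, colTerm, dotProduct_single, mul_one]
    by_cases h : ∀ l, l < k → (a ᵥ* (g - 1)) l = 0
    · rw [if_pos h, if_pos h]
    · rw [if_neg h, if_neg h, mul_zero]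
  have h2 : ∀ c ∈ agreeOff (· < k) (Pi.single k (1 : F)),
      ∑ a ∈ agreeOff (fun l : Fin n => 0 ≤ (l : ℕ) ∧ l < k) 0, θ ((a ᵥ* (g - 1)) ⬝ᵥ c) =
        (agreeOff (· < k) (Pi.single k (1 : F))).card *
          (if (g - 1) *ᵥ c = 0 then (1 : ℂ) else 0) := by
    intro c hc
    have hiff : (∀ l : Fin n, 0 ≤ (l : ℕ) ∧ l < k → ((g - 1) *ᵥ c) l = 0) ↔
        (g - 1) *ᵥ c = 0 := by
      refine ⟨fun h => funext fun l => ?_, fun h l _ => congrFun h l⟩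
      by_cases hl : l < k
      · exact h l ⟨Nat.zero_le _, hl⟩
      · simp only [Matrix.mulVec, dotProduct]
        refine Finset.sum_eq_zero fun m _ => ?_
        by_cases hlm : l < m
        · have hkm : k < m := (not_lt.1 hl).trans_lt hlm
          rw [mem_agreeOff.1 hc m (lt_asymm hkm), Pi.single_eq_of_ne hkm.ne', mul_zero]
        · rw [sub_one_apply_of_not_lt hg hlm, zero_mul]
    simp only [← Matrix.dotProduct_mulVec, dotProduct_comm _ ((g - 1) *ᵥ c)]
    rw [sum_agreeOff_addChar hθ, hcard, dotProduct_zero, AddChar.map_zero_eq_one, mul_one]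
    by_cases h : (g - 1) *ᵥ c = 0
    · rw [if_pos h, if_pos (hiff.2 h), mul_one]
    · rw [if_neg h, if_neg fun h' => h (hiff.1 h'), mul_zero]
  have h0 := card_agreeOff_ne_zero (· < k) (Pi.single k (1 : F))
  apply mul_left_cancel₀ h0
  rw [columnChar, Finset.mul_sum, Finset.mul_sum, ← Finset.sum_congr rfl h2,
    ← Finset.sum_congr rfl fun a _ => h1 a, Finset.sum_comm]

lemma sum_patternGroup_lt_col {N : ℕ} (f : (Fin (N + 1) → F) → ℂ) :
    ∑ y ∈ setFinset (patternGroup F (fun i j : Fin (N + 1) => i < j)),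
        f (fun i => y i (Fin.last N)) =
      (setFinset (patternGroup F
        (fun i j : Fin (N + 1) => i < j ∧ (j : ℕ) + 1 < N + 1))).card *
        ∑ c ∈ agreeOff (· < Fin.last N) (Pi.single (Fin.last N) (1 : F)), f c := by
  have hH : IsPatternOrder (fun i j : Fin (N + 1) => i < j ∧ (j : ℕ) + 1 < N + 1) :=
    ⟨fun _ _ h => h.1, fun _ _ _ h h' => ⟨h.1.trans h'.1, h'.2⟩⟩
  have hcard := sum_patternGroup_prod_cols (F := F) hH fun _ _ => 1
  have hsum := sum_patternGroup_prod_cols (F := F) (isPatternOrder_lt (n := N + 1))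
    fun j c => if j = Fin.last N then f c else 1
  simp only [Finset.prod_const_one, Finset.sum_const, nsmul_eq_mul, mul_one] at hcard
  simp only [Finset.prod_ite_eq', Finset.mem_univ, if_true] at hsum
  rw [hsum, hcard, Fin.prod_univ_castSucc, Fin.prod_univ_castSucc]
  have hlast : agreeOff (fun i : Fin (N + 1) => i < Fin.last N ∧
      ((Fin.last N : Fin (N + 1)) : ℕ) + 1 < N + 1) (Pi.single (Fin.last N) (1 : F)) =
      {Pi.single (Fin.last N) (1 : F)} := by
    ext c
    simp [mem_agreeOff, funext_iff]
  have hcast : ∀ j : Fin N, (fun i : Fin (N + 1) => i < j.castSucc ∧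
      (j.castSucc : ℕ) + 1 < N + 1) = (· < j.castSucc) := by
    intro j
    ext i
    simp
  simp only [hlast, hcast, Finset.card_singleton, Nat.cast_one, mul_one, if_true,
    (Fin.castSucc_lt_last _).ne, if_false, Finset.sum_const, nsmul_eq_mul]

lemma conj_mem_iff {N : ℕ} {g y : Matrix (Fin (N + 1)) (Fin (N + 1)) F}
    (hg : g ∈ patternGroup F (fun i j : Fin (N + 1) => i < j))
    (hy : y ∈ patternGroup F (fun i j : Fin (N + 1) => i < j)) :
    Ring.inverse y * g * y ∈
        patternGroup F (fun i j : Fin (N + 1) => i < j ∧ (j : ℕ) + 1 < N + 1) ↔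
      (g - 1) *ᵥ (fun i => y i (Fin.last N)) = 0 := by
  have hyU := isUnit_of_mem_patternGroup isPatternOrder_lt hy
  have hy' := inverse_mem_patternGroup isPatternOrder_lt hy
  have hmem := mul_mem_patternGroup isPatternOrder_lt
    (mul_mem_patternGroup isPatternOrder_lt hy' hg) hy
  have hconj : Ring.inverse y * g * y - 1 = Ring.inverse y * ((g - 1) * y) := by
    rw [sub_mul, one_mul, mul_sub, Ring.inverse_mul_cancel _ hyU, mul_assoc]
  have hcol : ∀ i, (Ring.inverse y * g * y - 1) i (Fin.last N) =
      (Ring.inverse y *ᵥ ((g - 1) *ᵥ (fun i => y i (Fin.last N)))) i := by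
    intro i
    rw [hconj]
    rfl
  have hinj : ∀ w : Fin (N + 1) → F, Ring.inverse y *ᵥ w = 0 → w = 0 := by
    intro w hw
    rw [← Matrix.one_mulVec w, ← Ring.mul_inverse_cancel _ hyU, ← Matrix.mulVec_mulVec, hw,
      Matrix.mulVec_zero]
  have hfix : (∀ i, (Ring.inverse y * g * y - 1) i (Fin.last N) = 0) ↔
      (g - 1) *ᵥ (fun i => y i (Fin.last N)) = 0 := by
    simp only [hcol]
    refine ⟨fun h => ?_, fun h i => by rw [h, Matrix.mulVec_zero, Pi.zero_apply]⟩
    exact hinj _ (funext h)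
  rw [← hfix]
  refine ⟨fun h i => ?_, fun h => ⟨hmem.1, fun i j hij h0 => ⟨hmem.2 i j hij h0, ?_⟩⟩⟩
  · rw [Matrix.sub_apply, apply_eq_of_mem_patternGroup h (by simp), sub_self]
  · by_contra hj
    obtain rfl : j = Fin.last N := Fin.ext (by have := j.2; simp; omega)
    have := h i
    rw [Matrix.sub_apply, Matrix.one_apply_ne hij, sub_zero] at this
    exact h0 this

lemma Ind_superchar_toMat {θ : AddChar F ℂ} (hθ : ∃ a, θ a ≠ 1) {N : ℕ} {mu : SPF F}
    (hmu : IsLabeledPartition N mu) {g : Matrix (Fin (N + 1)) (Fin (N + 1)) F}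
    (hg : g ∈ patternGroup F (fun i j : Fin (N + 1) => i < j)) :
    Ind (patternGroup F (fun i j : Fin (N + 1) => i < j))
        (patternGroup F (fun i j : Fin (N + 1) => i < j ∧ (j : ℕ) + 1 < N + 1))
        (superchar (fun i j : Fin (N + 1) => i < j ∧ (j : ℕ) + 1 < N + 1) θ
          (toMat F (N + 1) mu)) g =
      arcProd θ g (toMat F (N + 1) mu) * columnChar θ g 0 (Fin.last N) := by
  have hmu' : IsLabeledPartition (N + 1) mu :=
    ⟨fun i j h => by have := hmu.supp i j h; omega, hmu.row, hmu.col⟩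
  have hH : IsPatternOrder (fun i j : Fin (N + 1) => i < j ∧ (j : ℕ) + 1 < N + 1) :=
    ⟨fun _ _ h => h.1, fun _ _ _ h h' => ⟨h.1.trans h'.1, h'.2⟩⟩
  have hterm : ∀ y ∈ setFinset (patternGroup F (fun i j : Fin (N + 1) => i < j)),
      (if Ring.inverse y * g * y ∈
          patternGroup F (fun i j : Fin (N + 1) => i < j ∧ (j : ℕ) + 1 < N + 1)
        then superchar (fun i j : Fin (N + 1) => i < j ∧ (j : ℕ) + 1 < N + 1) θ
          (toMat F (N + 1) mu) (Ring.inverse y * g * y) else 0) =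
        arcProd θ g (toMat F (N + 1) mu) *
          (if (g - 1) *ᵥ (fun i => y i (Fin.last N)) = 0 then (1 : ℂ) else 0) := by
    intro y hy
    rw [mem_setFinset] at hy
    by_cases h : (g - 1) *ᵥ (fun i => y i (Fin.last N)) = 0
    · have hc := (conj_mem_iff hg hy).2 h
      rw [if_pos h, if_pos hc, mul_one, ← superchar_lt_toMat hθ hmu' hg,
        ← superchar_conj isPatternOrder_lt θ _ hg hy, superchar_lt_toMat hθ hmu'
          ⟨hc.1, fun i j hij h0 => (hc.2 i j hij h0).1⟩]
      refine superchar_toMat hθ hH ?_ hmu' ?_ hc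
      · intro i k j hij hik hkj
        exact ⟨⟨hik, by have := hij.2; have := Fin.lt_def.1 hkj; omega⟩, hkj, hij.2⟩
      · intro i j h0
        have := hmu.supp _ _ h0
        exact ⟨by rw [Fin.lt_def]; omega, by omega⟩
    · rw [if_neg h, if_neg fun h' => h ((conj_mem_iff hg hy).1 h'), mul_zero]
  rw [Ind, Finset.sum_congr rfl hterm, ← Finset.mul_sum,
    sum_patternGroup_lt_col fun c => if (g - 1) *ᵥ c = 0 then (1 : ℂ) else 0,
    card_fixed_columns hθ hg, mul_left_comm, inv_mul_cancel_left₀ card_patternGroup_ne_zero]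

end Induction

theorem induced_supercharacter_eq_star_product
    {n : ℕ} (hn : 0 < n) (F : Type*) [Field F] [Fintype F]
    (θ : F → ℂ) (hθadd : ∀ a b, θ (a + b) = θ a * θ b)
    (hθne : ∀ a, θ a ≠ 0) (hθnt : ∃ a, θ a ≠ 1)
    (mu : SPF F)
    (hsupp : ∀ i j, mu i j ≠ 0 → 1 ≤ i ∧ i < j ∧ j ≤ n - 1)
    (hrow : ∀ i j j', mu i j ≠ 0 → mu i j' ≠ 0 → j = j')
    (hcol : ∀ i i' j, mu i j ≠ 0 → mu i' j ≠ 0 → i = i') :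
    ∀ g ∈ patternGroup F (fun i j : Fin n => i < j),
      Ind (patternGroup F (fun i j : Fin n => i < j))
          (patternGroup F (fun i j : Fin n => i < j ∧ (j : ℕ) + 1 < n))
          (superchar (fun i j : Fin n => i < j ∧ (j : ℕ) + 1 < n) θ (toMat F n mu)) g =
        charOfComb (fun i j : Fin n => i < j) θ (lstar 1 n mu) g := by
  obtain ⟨N, rfl⟩ : ∃ N, n = N + 1 := ⟨n - 1, by omega⟩
  intro g hg
  have hθ0 : θ 0 = 1 := by
    have h := hθadd 0 0
    rw [add_zero] at h
    exact (mul_eq_left₀ (hθne 0)).1 h.symm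
  let θ' : AddChar F ℂ := ⟨θ, hθ0, hθadd⟩
  have hθ' : ∃ a, θ' a ≠ 1 := hθnt
  have hmu : IsLabeledPartition N mu := ⟨hsupp, hrow, hcol⟩
  refine (Ind_superchar_toMat hθ' hmu hg).trans (Eq.symm ?_)
  refine charOfComb_lstar hθ' hg N 0 (Fin.last N) mu (by simp)
    ⟨fun i j h => by have := hmu.supp i j h; omega, hrow, hcol⟩ fun a => ?_
  by_contra h
  have := hmu.supp _ _ h
  simp at this
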